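/- In the reduction instance (G', L') built from an MLCM-P path instance (G, L) (with ℓ = |L|² red lines in each direction of each red cross), for every original edge e of the path, any feasible line layout of (G', L') has at least ℓ_e^t·ℓ + 2·ℓ_e^m·ℓ + ℓ² crossings on e in which at least one red line of the red cross of e is involved, where ℓ_e^t and ℓ_e^m are the numbers of lines of L on e with, respectively without, a terminal at an endpoint of e. -/

import Mathlib

/-!
Core model for metro-line crossing minimization (MLCM).

An embedded graph is a symmetric loopless graph together with, for each
vertex, a list of its neighbours in clockwise order (the embedding).
A line is a simple path in the graph.  A line layout assigns to each
ordered pair `(u, v)` forming an edge the clockwise order `ord u v` in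
which the lines through `{u, v}` meet the port of `u`.
-/

structure EmbeddedGraph (V : Type) where
  adj : V → V → Prop
  symm : ∀ {u v}, adj u v → adj v u
  loopless : ∀ v, ¬ adj v v
  rot : V → List V
  rot_mem : ∀ u v, v ∈ rot u ↔ adj u v
  rot_nodup : ∀ u, (rot u).Nodup

/-- `p` is a simple path (with at least one edge) in `G`. -/
def EmbeddedGraph.IsPath {V : Type} (G : EmbeddedGraph V) (p : List V) : Prop :=
  p.Nodup ∧ 2 ≤ p.length ∧ p.Chain' G.adj

/-- An instance of MLCM: an embedded graph together with a set of lines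
(indexed by `ι`), each a simple path. -/
structure MLCMInstance (V ι : Type) where
  G : EmbeddedGraph V
  line : ι → List V
  line_path : ∀ i, G.IsPath (line i)

namespace MLCMInstance

variable {V ι : Type}

/-- Line `i` passes through the edge `{u, v}`. -/
def usesEdge (M : MLCMInstance V ι) (i : ι) (u v : V) : Prop :=
  [u, v] <:+: M.line i ∨ [v, u] <:+: M.line i

/-- `u` is a terminal (an endpoint) of line `i`. -/
def Terminal (M : MLCMInstance V ι) (i : ι) (u : V) : Prop :=
  (M.line i).head? = some u ∨ (M.line i).getLast? = some u

/-- A line layout: for each ordered pair `(u, v)`, the clockwise order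
(at the port of `u`) of the lines through the edge `{u, v}`. -/
structure Layout (M : MLCMInstance V ι) where
  ord : V → V → List ι
  nodup : ∀ u v, (ord u v).Nodup
  mem_iff : ∀ u v i, i ∈ ord u v ↔ M.usesEdge i u v

variable {M : MLCMInstance V ι}

/-- Lines `i` and `j` have an edge crossing on the edge `{u, v}`:
they appear in the same relative order in both port orders. -/
def EdgeCross (lay : M.Layout) (i j : ι) (u v : V) : Prop :=
  i ≠ j ∧ List.Sublist [i, j] (lay.ord u v) ∧ List.Sublist [i, j] (lay.ord v u)

/-- The cyclic concatenation of the port orders at `u`, following the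
clockwise order of the edges incident to `u`. -/
def cyclicAt (lay : M.Layout) (u : V) : List ι :=
  (M.G.rot u).flatMap fun w => lay.ord u w

/-- Lines `i` and `j` have a vertex crossing at `u`: they alternate
`… i … j … i … j …` in the cyclic concatenation of the port orders. -/
def VertexCross (lay : M.Layout) (i j : ι) (u : V) : Prop :=
  i ≠ j ∧ ∃ n, List.Sublist [i, j, i, j] ((cyclicAt lay u).rotate n)

/-- Lines `i` and `j` cross in the layout. -/
def Crosses (lay : M.Layout) (i j : ι) : Prop :=
  (∃ u v, EdgeCross lay i j u v ∨ EdgeCross lay j i u v) ∨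
  (∃ u, VertexCross lay i j u ∨ VertexCross lay j i u)

/-- The pair of lines `i, j` has an unavoidable crossing: the lines
cross in every line layout. -/
def Unavoidable (M : MLCMInstance V ι) (i j : ι) : Prop :=
  ∀ lay : M.Layout, Crosses lay i j

/-- A vertex crossing of `i, j` at `u` is unavoidable: it occurs in
every line layout. -/
def UnavoidableVC (M : MLCMInstance V ι) (i j : ι) (u : V) : Prop :=
  ∀ lay : M.Layout, VertexCross lay i j u ∨ VertexCross lay j i u

/-- A layout is feasible when it contains no avoidable vertex crossings. -/
def Feasible (lay : M.Layout) : Prop :=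
  ∀ i j u, VertexCross lay i j u → M.UnavoidableVC i j u

/-- A layout is crossing-free when no two lines cross in it. -/
def CrossingFree (lay : M.Layout) : Prop :=
  ∀ i j, i ≠ j → ¬ Crosses lay i j

/-- The periphery condition: at every port the lines terminating at that
vertex occupy the outermost positions of the port order. -/
def Periphery (lay : M.Layout) : Prop :=
  ∀ u v, ∃ s₁ s₂ s₃ : List ι, lay.ord u v = s₁ ++ s₂ ++ s₃ ∧
    (∀ i ∈ s₁, M.Terminal i u) ∧ (∀ i ∈ s₂, ¬ M.Terminal i u) ∧
    (∀ i ∈ s₃, M.Terminal i u)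

/-- `P` occurs as a (contiguous) subpath of line `i` (in either direction). -/
def InfixOf (M : MLCMInstance V ι) (i : ι) (P : List V) : Prop :=
  P <:+: M.line i ∨ P.reverse <:+: M.line i

/-- `P` is a common subpath (with at least one edge) of lines `i` and `j`. -/
def CommonSubpath (M : MLCMInstance V ι) (i j : ι) (P : List V) : Prop :=
  2 ≤ P.length ∧ M.InfixOf i P ∧ M.InfixOf j P

/-- `P` is the (maximal) common subpath of lines `i` and `j`. -/
def MaxCommonSubpath (M : MLCMInstance V ι) (i j : ι) (P : List V) : Prop :=
  M.CommonSubpath i j P ∧ ∀ Q, M.CommonSubpath i j Q → Q.length ≤ P.length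

/-- No line is a subpath of another line. -/
def ProperLines (M : MLCMInstance V ι) : Prop :=
  ∀ i j, i ≠ j → ¬ M.InfixOf j (M.line i)

/-- Relative to the edge directed from `u` to `v`: line `i` is above
line `j` in every crossing-free solution. -/
def MustAbove (M : MLCMInstance V ι) (i j : ι) (u v : V) : Prop :=
  ∀ lay : M.Layout, Feasible lay → CrossingFree lay → List.Sublist [i, j] (lay.ord u v)

/-- `i, j` is an overlapping pair with common subpath `P` from `u` to `v`:
`i` has its terminal at `u`, and `j` has its terminal at `v`. -/
def OverlappingPair (M : MLCMInstance V ι) (i j : ι) (P : List V) (u v : V) : Prop :=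
  i ≠ j ∧ M.MaxCommonSubpath i j P ∧ P.head? = some u ∧ P.getLast? = some v ∧
    M.Terminal i u ∧ M.Terminal j v ∧ ¬ M.Terminal i v ∧ ¬ M.Terminal j u

/-- `l` is a separator of the overlapping pair `i, j` with common subpath `P`:
on `P`, in every crossing-free solution, `l` lies between `i` and `j`. -/
def Separator (M : MLCMInstance V ι) (i j : ι) (P : List V) (l : ι) : Prop :=
  l ≠ i ∧ l ≠ j ∧ ∃ u v, [u, v] <:+: P ∧
    ((M.MustAbove i l u v ∧ M.MustAbove l j u v) ∨
     (M.MustAbove j l u v ∧ M.MustAbove l i u v))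

end MLCMInstance

namespace MLCMInstance

variable {n : ℕ} {ι : Type}

/-- The number of (edge) crossings of a layout: the number of pairs
(pair of lines, edge) such that the two lines cross on that edge.
(Unavoidable vertex crossings are not counted.) -/
noncomputable def crossingCount {V : Type} (M : MLCMInstance V ι) (lay : M.Layout) : ℕ :=
  Nat.card {q : (ι × ι) × Sym2 V //
    ∃ u v : V, q.2 = s(u, v) ∧ EdgeCross lay q.1.1 q.1.2 u v}

/-- `ℓ_e^t`: the number of lines on the path edge `e = (e, e+1)` that have a
terminal at an endpoint of `e`. -/
noncomputable def termLineCount (M : MLCMInstance (Fin n) ι) (e : Fin (n - 1)) : ℕ :=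
  Nat.card {i : ι //
    M.usesEdge i ⟨e.val, by have := e.isLt; omega⟩ ⟨e.val + 1, by have := e.isLt; omega⟩ ∧
    (M.Terminal i ⟨e.val, by have := e.isLt; omega⟩ ∨
     M.Terminal i ⟨e.val + 1, by have := e.isLt; omega⟩)}

/-- `ℓ_e^m`: the number of lines on the path edge `e = (e, e+1)` that have no
terminal at an endpoint of `e`. -/
noncomputable def midLineCount (M : MLCMInstance (Fin n) ι) (e : Fin (n - 1)) : ℕ :=
  Nat.card {i : ι //
    M.usesEdge i ⟨e.val, by have := e.isLt; omega⟩ ⟨e.val + 1, by have := e.isLt; omega⟩ ∧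
    ¬ (M.Terminal i ⟨e.val, by have := e.isLt; omega⟩ ∨
       M.Terminal i ⟨e.val + 1, by have := e.isLt; omega⟩)}

/-- `K := |E| ⬝ ℓ² + ∑ₑ (ℓ_e^t + 2 ℓ_e^m) ⬝ ℓ`, with `ℓ = |L|²`. -/
noncomputable def Kconst (M : MLCMInstance (Fin n) ι) : ℕ :=
  (n - 1) * (Nat.card ι ^ 2) ^ 2 +
    ∑ e : Fin (n - 1), (M.termLineCount e + 2 * M.midLineCount e) * Nat.card ι ^ 2

end MLCMInstance

namespace List

variable {α β : Type*}

theorem pair_sublist_or {l : List α} {x y : α} (hx : x ∈ l) (hy : y ∈ l)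
    (hxy : x ≠ y) : [x, y] <+ l ∨ [y, x] <+ l := by
  obtain ⟨s, t, rfl⟩ := append_of_mem hx
  rcases mem_append.1 hy with hy | hy
  · right
    exact (singleton_sublist.2 hy).append (singleton_sublist.2 mem_cons_self)
  · left
    have hy : y ∈ t := by simpa [hxy.symm] using hy
    exact ((singleton_sublist.2 hy).cons_cons x).trans (sublist_append_right _ _)

theorem Nodup.pair_sublist_trans {l : List α} (h : l.Nodup) {x y z : α}
    (hxy : [x, y] <+ l) (hyz : [y, z] <+ l) : [x, z] <+ l := by
  induction l with
  | nil => simp at hxy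
  | cons a l ih =>
    have hn := nodup_cons.1 h
    rcases sublist_cons_iff.1 hxy with hxy | ⟨r, hr, hxy⟩
    · rcases sublist_cons_iff.1 hyz with hyz | ⟨r, hr, hyz⟩
      · exact (ih hn.2 hxy hyz).cons a
      · have hya : y = a := by simpa using congrArg List.head? hr
        exact absurd (hya ▸ hxy.subset (by simp : y ∈ [x, y])) hn.1
    · obtain ⟨rfl, rfl⟩ : x = a ∧ [y] = r := by simpa using hr
      have hz : z ∈ l := by
        rcases sublist_cons_iff.1 hyz with hyz | ⟨r, hr, hyz⟩
        · exact hyz.subset (by simp)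
        · obtain ⟨rfl, rfl⟩ : y = x ∧ [z] = r := by simpa using hr
          exact hyz.subset (by simp)
      exact (singleton_sublist.2 hz).cons_cons x

theorem IsRotated.flatMap {l l' : List α} (h : l ~r l') (f : α → List β) :
    l.flatMap f ~r l'.flatMap f := by
  obtain ⟨k, rfl⟩ := h
  rw [rotate_eq_drop_append_take_mod, flatMap_append]
  conv_lhs => rw [← take_append_drop (k % l.length) l, flatMap_append]
  exact isRotated_append

theorem IsRotated.filter {l l' : List α} (h : l ~r l') (p : α → Bool) :
    l.filter p ~r l'.filter p := by
  obtain ⟨k, rfl⟩ := h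
  rw [rotate_eq_drop_append_take_mod, filter_append]
  conv_lhs => rw [← take_append_drop (k % l.length) l, filter_append]
  exact isRotated_append

theorem Nodup.filter_eq_of_sublist [DecidableEq α] {l s : List α} (h : l.Nodup) (hs : s <+ l) :
    l.filter (· ∈ s) = s := by
  have h1 : s <+ l.filter (· ∈ s) := by
    have := hs.filter (· ∈ s)
    rwa [filter_eq_self.2 (by simp)] at this
  refine (h1.eq_of_length_le ?_).symm
  exact ((h.filter _).subperm fun a ha => by simpa using (mem_filter.1 ha).2).length_le

theorem flatMap_filter_of_eq_nil {l : List α} {f : α → List β} (p : α → Bool)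
    (h : ∀ a ∈ l, p a = false → f a = []) : (l.filter p).flatMap f = l.flatMap f := by
  induction l with
  | nil => rfl
  | cons a l ih =>
    have ih := ih fun b hb => h b (mem_cons_of_mem _ hb)
    cases hp : p a
    · simp [hp, ih, h a mem_cons_self hp]
    · simp [hp, ih]

theorem Nodup.eq_singleton {l : List α} (h : l.Nodup) {x : α} (hx : ∀ a, a ∈ l ↔ a = x) :
    l = [x] :=
  perm_singleton.1 ((perm_ext_iff_of_nodup h (nodup_singleton x)).2 (by simpa using hx))

theorem not_isRotated_alternating {x y : α} (h : x ≠ y) : ¬ [x, y, x, y] ~r [x, x, y, y] := by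
  rintro ⟨k, hk⟩
  rw [← rotate_mod] at hk
  have hlt : k % [x, y, x, y].length < 4 := Nat.mod_lt _ (by simp)
  generalize k % [x, y, x, y].length = m at hk hlt
  interval_cases m <;> simp_all [rotate, h.symm]

theorem pair_infix_cons_cons {a b c d : α} {l : List α} :
    [a, b] <:+: c :: d :: l ↔ (a = c ∧ b = d) ∨ [a, b] <:+: d :: l := by
  simp [infix_cons_iff (a := c)]

theorem pair_infix_map {f : α → β} (hf : f.Injective) {a b : α} {l : List α} :
    [f a, f b] <:+: l.map f ↔ [a, b] <:+: l :=
  ⟨fun h => by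
    obtain ⟨l', hl', h⟩ := infix_map_iff.1 h
    rwa [← hf.list_map (show [a, b].map f = l'.map f from h)] at hl', fun h => h.map f⟩

end List

namespace MLCMInstance

open List

variable {V ι : Type} {M : MLCMInstance V ι}

theorem usesEdge.symm {i : ι} {u v : V} (h : M.usesEdge i u v) : M.usesEdge i v u := Or.symm h

theorem usesEdge.adj {i : ι} {u v : V} (h : M.usesEdge i u v) : M.G.adj u v := by
  have key : ∀ {a b : V}, [a, b] <:+: M.line i → M.G.adj a b := fun hab => by
    simpa using (M.line_path i).2.2.infix hab
  exact h.elim key fun h => M.G.symm (key h)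

/-- A line that does not end at `u` leaves `u` by a second edge. -/
theorem usesEdge.exists_ne {i : ι} {u v : V} (h : M.usesEdge i u v) (hu : ¬ M.Terminal i u) :
    ∃ t, t ≠ v ∧ M.usesEdge i u t := by
  have hnd := (M.line_path i).1
  unfold Terminal at hu
  rcases h with ⟨s, t, hst⟩ | ⟨s, t, hst⟩
  · rcases s.eq_nil_or_concat with rfl | ⟨s, a, rfl⟩
    · exact absurd (Or.inl (by simp [← hst])) hu
    · refine ⟨a, ?_, Or.inr ⟨s, v :: t, by simpa using hst⟩⟩
      rintro rfl
      simp [← hst, nodup_append] at hnd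
  · rcases t with _ | ⟨a, t⟩
    · exact absurd (Or.inr (by simp [← hst])) hu
    · refine ⟨a, ?_, Or.inl ⟨s ++ [v], t, by simpa using hst⟩⟩
      rintro rfl
      simp [← hst, nodup_append] at hnd

/-- A line with at least two edges does not end at both endpoints of an edge. -/
theorem usesEdge.not_terminal_both {i : ι} {u v : V} (h : M.usesEdge i u v)
    (hlen : 3 ≤ (M.line i).length) : ¬ (M.Terminal i u ∧ M.Terminal i v) := by
  wlog huv : [u, v] <:+: M.line i generalizing u v
  · exact fun ht => this h.symm (h.resolve_left huv) ht.symm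
  obtain ⟨s, t, hst⟩ := huv
  have hnd := (M.line_path i).1
  unfold Terminal
  rintro ⟨hu, hv⟩
  rw [← hst] at hnd hlen hu hv
  rcases s with _ | ⟨a, s⟩ <;> rcases t.eq_nil_or_concat with rfl | ⟨t, b, rfl⟩ <;>
    simp [nodup_append, List.getLast?_cons] at hnd hlen hu hv <;> grind

open Classical in
/-- The layout obtained by moving the line `x` to the front of every port order. -/
noncomputable def Layout.moveToFront (lay : M.Layout) (x : ι) : M.Layout where
  ord u v := (lay.ord u v).filter (· = x) ++ (lay.ord u v).filter (· ≠ x)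
  nodup u v := by
    refine ((lay.nodup u v).filter _).append ((lay.nodup u v).filter _) ?_
    intro a ha hb
    simp_all
  mem_iff u v i := by
    rw [← lay.mem_iff u v i]
    by_cases h : i = x <;> simp [h]

theorem Layout.pair_sublist_moveToFront (lay : M.Layout) {x y : ι} {u v : V} (hxy : x ≠ y)
    (hx : x ∈ lay.ord u v) (hy : y ∈ lay.ord u v) :
    [x, y] <+ (lay.moveToFront x).ord u v := by
  classical
  exact (singleton_sublist.2 (by simpa using hx)).append
    (singleton_sublist.2 (by simpa [hxy.symm] using hy))

theorem usesEdge_of_line_eq {i : ι} {p q r s : V} (h : M.line i = [p, q, r, s]) (t : V) :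
    (M.usesEdge i q t ↔ t = p ∨ t = r) ∧ (M.usesEdge i r t ↔ t = s ∨ t = q) := by
  have hnd := (M.line_path i).1
  have hsingle : ∀ a b c : V, ¬ [a, b] <:+: [c] := fun a b c h => by simpa using h.length_le
  simp only [h, nodup_cons, mem_cons, not_mem_nil, or_false, not_or] at hnd
  simp only [usesEdge, h, pair_infix_cons_cons, hsingle]
  grind

section Alternation

variable {x y : ι} {u a w b : V}

/-- If `x` leaves `u` by the ports `a`, `w` and `y` by the ports `w`, `b`, where `a`, `w`, `b`
appear in clockwise order, and `x` precedes `y` at `w`, then they do not cross at `u`. -/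
theorem cyclicAt_not_alternating (lay : M.Layout) (hxy : x ≠ y)
    (hrot : ∃ k, [a, w, b] <+ (M.G.rot u).rotate k)
    (hx : ∀ t, M.usesEdge x u t ↔ t = a ∨ t = w) (hy : ∀ t, M.usesEdge y u t ↔ t = w ∨ t = b)
    (hord : [x, y] <+ lay.ord u w) {l : List ι} (hl : l ~r [x, y, x, y]) {m : ℕ} :
    ¬ l <+ (cyclicAt lay u).rotate m := by
  classical
  obtain ⟨k, hk⟩ := hrot
  intro hsub
  let p : ι → Bool := fun i => i = x ∨ i = y
  let f : V → List ι := fun t => (lay.ord u t).filter p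
  have hnd : ((M.G.rot u).rotate k).Nodup := nodup_rotate.2 (M.G.rot_nodup u)
  have hawb := hnd.sublist hk
  simp only [nodup_cons, mem_cons, not_mem_nil, or_false, not_or] at hawb
  have hfnd : ∀ t, (f t).Nodup := fun t => (lay.nodup u t).filter _
  have hf : ∀ t i, i ∈ f t ↔ (i = x ∧ (t = a ∨ t = w)) ∨ (i = y ∧ (t = w ∨ t = b)) := by
    intro t i
    simp only [f, p, mem_filter, lay.mem_iff, decide_eq_true_eq]
    constructor
    · rintro ⟨h, rfl | rfl⟩
      · exact Or.inl ⟨rfl, (hx t).1 h⟩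
      · exact Or.inr ⟨rfl, (hy t).1 h⟩
    · rintro (⟨rfl, h⟩ | ⟨rfl, h⟩)
      · exact ⟨(hx t).2 h, Or.inl rfl⟩
      · exact ⟨(hy t).2 h, Or.inr rfl⟩
  have hfa : f a = [x] := (hfnd a).eq_singleton fun i => by rw [hf]; tauto
  have hfb : f b = [y] := (hfnd b).eq_singleton fun i => by
    rw [hf]
    have : b ≠ a := fun h => hawb.1.2 h.symm
    have : b ≠ w := fun h => hawb.2.1 h.symm
    tauto
  have hfw : f w = [x, y] := by
    have h1 : [x, y] <+ f w := by
      have := hord.filter p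
      rwa [filter_eq_self.2 (by simp [p])] at this
    refine (h1.eq_of_length_le ?_).symm
    refine ((hfnd w).subperm fun i hi => ?_).length_le
    have := (hf w i).1 hi
    simp only [mem_cons, not_mem_nil, or_false]
    tauto
  have hcyc : (cyclicAt lay u).filter p ~r [x, x, y, y] := by
    have h1 : (M.G.rot u).flatMap f ~r ((M.G.rot u).rotate k).flatMap f :=
      IsRotated.flatMap ⟨k, rfl⟩ f
    have h2 : ((M.G.rot u).rotate k).flatMap f = [x, x, y, y] := by
      rw [← flatMap_filter_of_eq_nil (· ∈ [a, w, b]), hnd.filter_eq_of_sublist hk]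
      · simp [hfa, hfb, hfw]
      · intro t _ ht
        refine eq_nil_iff_forall_not_mem.2 fun i hi => ?_
        have := (hf t i).1 hi
        simp only [mem_cons, not_mem_nil, or_false, decide_eq_false_iff_not] at ht
        tauto
    rw [h2] at h1
    simpa only [cyclicAt, filter_flatMap] using h1
  have hrot' : ((cyclicAt lay u).rotate m).filter p ~r [x, x, y, y] :=
    (IsRotated.filter (IsRotated.symm ⟨m, rfl⟩) p).trans hcyc
  have hle : l <+ ((cyclicAt lay u).rotate m).filter p := by
    have := hsub.filter p
    rwa [filter_eq_self.2 fun i hi => by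
      have := hl.mem_iff.1 hi
      simp only [mem_cons, not_mem_nil, or_false] at this
      simp only [p, decide_eq_true_eq]
      tauto] at this
  have heq := hle.eq_of_length (by rw [hl.perm.length_eq, hrot'.perm.length_eq]; rfl)
  exact not_isRotated_alternating hxy (hl.symm.trans (heq ▸ hrot'))

/-- In a feasible layout, a line turning to `a` precedes at the port `w` a line turning to `b`
if the ports `a`, `w`, `b` appear in clockwise order. -/
theorem Feasible.pair_sublist {lay : M.Layout} (hlay : Feasible lay) (hxy : x ≠ y)
    (hrot : ∃ k, [a, w, b] <+ (M.G.rot u).rotate k)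
    (hx : ∀ t, M.usesEdge x u t ↔ t = a ∨ t = w) (hy : ∀ t, M.usesEdge y u t ↔ t = w ∨ t = b) :
    [x, y] <+ lay.ord u w := by
  have hxw : x ∈ lay.ord u w := by simp [lay.mem_iff, hx]
  have hyw : y ∈ lay.ord u w := by simp [lay.mem_iff, hy]
  refine (pair_sublist_or hxw hyw hxy).resolve_right fun hyx => ?_
  have hcross : VertexCross lay x y u := by
    obtain ⟨k, hk⟩ := hrot
    obtain ⟨m, hm⟩ : cyclicAt lay u ~r ((M.G.rot u).rotate k).flatMap fun w => lay.ord u w :=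
      IsRotated.flatMap ⟨k, rfl⟩ _
    refine ⟨hxy, m, ?_⟩
    rw [hm]
    refine Sublist.trans ?_ (hk.flatMap _)
    have hxa : [x] <+ lay.ord u a := singleton_sublist.2 (by simp [lay.mem_iff, hx])
    have hyb : [y] <+ lay.ord u b := singleton_sublist.2 (by simp [lay.mem_iff, hy])
    simpa using hxa.append (hyx.append hyb)
  have hfront := lay.pair_sublist_moveToFront hxy hxw hyw
  rcases hlay x y u hcross (lay.moveToFront x) with ⟨-, m, hm⟩ | ⟨-, m, hm⟩
  · exact cyclicAt_not_alternating _ hxy hrot hx hy hfront (IsRotated.refl _) hm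
  · exact cyclicAt_not_alternating _ hxy hrot hx hy hfront ⟨1, rfl⟩ hm

end Alternation

theorem card_add_card_le {ι ρ : Type*} [Finite ι] [Finite ρ] {k : ℕ}
    (P : (ι ⊕ ρ) × (ι ⊕ ρ) → Prop) (A B : ι → Prop) (r s : Fin k → ρ)
    (hr : r.Injective) (hs : s.Injective) (hAB : ∀ i, A i → ¬ B i)
    (hA : ∀ i, A i → ∀ c, P (.inr (r c), .inl i) ∨ P (.inl i, .inr (s c)))
    (hB : ∀ i, B i → ∀ c, P (.inr (r c), .inl i) ∧ P (.inl i, .inr (s c)))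
    (hrs : ∀ c d, P (.inr (r c), .inr (s d))) :
    Nat.card {i // A i} * k + 2 * Nat.card {i // B i} * k + k ^ 2 ≤ Nat.card {q // P q} := by
  classical
  let g : ({i // A i} × Fin k) ⊕ ({i // B i} × Fin k × Bool) ⊕ (Fin k × Fin k) →
      (ι ⊕ ρ) × (ι ⊕ ρ) := fun x => match x with
    | .inl (i, c) => if P (.inr (r c), .inl i) then (.inr (r c), .inl i) else (.inl i, .inr (s c))
    | .inr (.inl (i, c, true)) => (.inr (r c), .inl i)
    | .inr (.inl (i, c, false)) => (.inl i, .inr (s c))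
    | .inr (.inr (c, d)) => (.inr (r c), .inr (s d))
  have hg : ∀ x, P (g x) := by
    rintro (⟨⟨i, hi⟩, c⟩ | ⟨⟨i, hi⟩, c, _ | _⟩ | ⟨c, d⟩)
    · have := hA i hi c
      grind
    · exact (hB i hi c).2
    · exact (hB i hi c).1
    · exact hrs c d
  have hinj : g.Injective := by
    rintro (⟨⟨i, hi⟩, c⟩ | ⟨⟨i, hi⟩, c, _ | _⟩ | ⟨c, d⟩)
      (⟨⟨j, hj⟩, c'⟩ | ⟨⟨j, hj⟩, c', _ | _⟩ | ⟨c', d'⟩) h <;>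
      simp only [g] at h <;> (try split_ifs at h) <;>
      simp only [Prod.mk.injEq, Sum.inl.injEq, Sum.inr.injEq, reduceCtorEq, hr.eq_iff, hs.eq_iff,
        and_false, false_and] at h <;> grind
  have := Nat.card_le_card_of_injective (fun x => (⟨g x, hg x⟩ : {q // P q}))
    fun x y h => hinj (congrArg Subtype.val h)
  simp only [Nat.card_sum, Nat.card_prod, Nat.card_eq_fintype_card (α := Fin k), Fintype.card_fin,
    Nat.card_eq_fintype_card (α := Bool), Fintype.card_bool] at this
  calc _ = _ := by ring
    _ ≤ _ := this

end MLCMInstance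

open MLCMInstance in
/-- In the reduction instance `(G', L')` built from an
MLCM-P path instance `(G, L)` (with `ℓ = |L|²` red lines in each direction of
each red cross), for every original edge `e` of the path, any feasible line
layout of `(G', L')` has at least `ℓₑᵗℓ + 2ℓₑᵐℓ + ℓ²` crossings on `e` in
which at least one red line of the red cross of `e` is involved. -/
theorem red_cross_forces_crossings
    {n : ℕ} {ι : Type} [Fintype ι] (hn : 2 ≤ n)
    -- the original instance: an MLCM-P instance on a path with `n` vertices,
    -- embedded along a horizontal line
    (M : MLCMInstance (Fin n) ι)
    (hMadj : ∀ a b : Fin n, M.G.adj a b ↔ (a.val + 1 = b.val ∨ b.val + 1 = a.val))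
    (hMrot0 : M.G.rot ⟨0, by omega⟩ = [⟨1, by omega⟩])
    (hMrotLast : M.G.rot ⟨n - 1, by omega⟩ = [⟨n - 2, by omega⟩])
    (hMrotInt : ∀ (u : ℕ) (h1 : 0 < u) (h2 : u < n - 1),
      M.G.rot ⟨u, by omega⟩ = [⟨u + 1, by omega⟩, ⟨u - 1, by omega⟩])
    -- no line of `L` lies entirely on a single edge
    (hlong : ∀ i : ι, 3 ≤ (M.line i).length)
    -- the reduced MLCM instance `(G', L')`: to each edge `e = (u, v)` of the
    -- path a red cross is added, with vertices `u₁ = (e,0)`, `u₂ = (e,1)`,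
    -- `v₁ = (e,2)`, `v₂ = (e,3)` (`u₁, v₁` above and `u₂, v₂` below the
    -- path), and `ℓ = |L|²` red lines from `u₁` to `v₂` (`true`) as well as
    -- `ℓ` red lines from `u₂` to `v₁` (`false`)
    (M' : MLCMInstance (Fin n ⊕ (Fin (n - 1) × Fin 4))
      (ι ⊕ (Fin (n - 1) × Fin (Nat.card ι ^ 2) × Bool)))
    (hold : ∀ i : ι, M'.line (Sum.inl i) = (M.line i).map Sum.inl)
    (hredT : ∀ (e : Fin (n - 1)) (c : Fin (Nat.card ι ^ 2)),
      M'.line (Sum.inr (e, c, true)) =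
        [Sum.inr (e, 0), Sum.inl ⟨e.val, by have := e.isLt; omega⟩,
         Sum.inl ⟨e.val + 1, by have := e.isLt; omega⟩, Sum.inr (e, 3)])
    (hredF : ∀ (e : Fin (n - 1)) (c : Fin (Nat.card ι ^ 2)),
      M'.line (Sum.inr (e, c, false)) =
        [Sum.inr (e, 1), Sum.inl ⟨e.val, by have := e.isLt; omega⟩,
         Sum.inl ⟨e.val + 1, by have := e.isLt; omega⟩, Sum.inr (e, 2)])
    (hadj' : ∀ a b : Fin n ⊕ (Fin (n - 1) × Fin 4), M'.G.adj a b ↔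
      ((∃ u v : Fin n, a = Sum.inl u ∧ b = Sum.inl v ∧
          (u.val + 1 = v.val ∨ v.val + 1 = u.val)) ∨
       (∃ (u : Fin n) (e : Fin (n - 1)) (p : Fin 4),
          ((a = Sum.inl u ∧ b = Sum.inr (e, p)) ∨
           (a = Sum.inr (e, p) ∧ b = Sum.inl u)) ∧
          ((u.val = e.val ∧ (p = 0 ∨ p = 1)) ∨
           (u.val = e.val + 1 ∧ (p = 2 ∨ p = 3))))))
    -- the embedding of `G'`: clockwise rotations at the path vertices ...
    (hrot'0 : M'.G.rot (Sum.inl ⟨0, by omega⟩) =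
      [Sum.inr (⟨0, by omega⟩, 0), Sum.inl ⟨1, by omega⟩, Sum.inr (⟨0, by omega⟩, 1)])
    (hrot'Last : M'.G.rot (Sum.inl ⟨n - 1, by omega⟩) =
      [Sum.inr (⟨n - 2, by omega⟩, 2), Sum.inr (⟨n - 2, by omega⟩, 3),
       Sum.inl ⟨n - 2, by omega⟩])
    (hrot'Int : ∀ (u : ℕ) (h1 : 0 < u) (h2 : u < n - 1),
      M'.G.rot (Sum.inl ⟨u, by omega⟩) =
        [Sum.inr (⟨u - 1, by omega⟩, 2), Sum.inr (⟨u, by omega⟩, 0),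
         Sum.inl ⟨u + 1, by omega⟩, Sum.inr (⟨u, by omega⟩, 1),
         Sum.inr (⟨u - 1, by omega⟩, 3), Sum.inl ⟨u - 1, by omega⟩])
    -- ... and at the leaf vertices of the red crosses
    (hrot'Leaf : ∀ (e : Fin (n - 1)) (p : Fin 4),
      M'.G.rot (Sum.inr (e, p)) =
        [Sum.inl (if p.val ≤ 1 then ⟨e.val, by have := e.isLt; omega⟩
                  else ⟨e.val + 1, by have := e.isLt; omega⟩)])
    : ∀ lay' : M'.Layout, Feasible lay' → ∀ e : Fin (n - 1),
      M.termLineCount e * Nat.card ι ^ 2 +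
        2 * M.midLineCount e * Nat.card ι ^ 2 + (Nat.card ι ^ 2) ^ 2 ≤
      Nat.card {q : (ι ⊕ (Fin (n - 1) × Fin (Nat.card ι ^ 2) × Bool)) ×
          (ι ⊕ (Fin (n - 1) × Fin (Nat.card ι ^ 2) × Bool)) //
        EdgeCross lay' q.1 q.2
          (Sum.inl ⟨e.val, by have := e.isLt; omega⟩)
          (Sum.inl ⟨e.val + 1, by have := e.isLt; omega⟩) ∧
        ((∃ c, q.1 = Sum.inr (e, c)) ∨ (∃ c, q.2 = Sum.inr (e, c)))} := by
  intro lay hlay e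
  have he := e.isLt
  set U : Fin n := ⟨e.val, by omega⟩ with hU
  set W : Fin n := ⟨e.val + 1, by omega⟩ with hW
  have hUW : U ≠ W := by simp [hU, hW, Fin.ext_iff]
  have hrotU : (e.val = 0 ∧ M'.G.rot (Sum.inl U) =
        [Sum.inr (e, 0), Sum.inl W, Sum.inr (e, 1)]) ∨
      ∃ (T : Fin n) (e' : Fin (n - 1)), T.val + 1 = e.val ∧ M'.G.rot (Sum.inl U) =
        [Sum.inr (e', 2), Sum.inr (e, 0), Sum.inl W, Sum.inr (e, 1), Sum.inr (e', 3),
          Sum.inl T] := by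
    rcases Nat.eq_zero_or_pos e.val with h0 | h0
    · left
      obtain ⟨e, _⟩ := e
      obtain rfl : e = 0 := h0
      exact ⟨rfl, hrot'0⟩
    · have hlt : e.val - 1 < n - 1 := by omega
      exact Or.inr ⟨⟨e.val - 1, by omega⟩, ⟨e.val - 1, hlt⟩, Nat.sub_add_cancel h0,
        hrot'Int e.val h0 he⟩
  have hrotW : (e.val + 1 = n - 1 ∧ M'.G.rot (Sum.inl W) =
        [Sum.inr (e, 2), Sum.inr (e, 3), Sum.inl U]) ∨
      ∃ (T : Fin n) (e' : Fin (n - 1)), T.val = W.val + 1 ∧ M'.G.rot (Sum.inl W) =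
        [Sum.inr (e, 2), Sum.inr (e', 0), Sum.inl T, Sum.inr (e', 1), Sum.inr (e, 3),
          Sum.inl U] := by
    rcases Nat.eq_or_lt_of_le (show e.val + 1 ≤ n - 1 from he) with h1 | h1
    · left
      refine ⟨h1, ?_⟩
      clear hrotU
      have hw : W = ⟨n - 1, by omega⟩ := Fin.ext h1
      have hu : U = ⟨n - 2, by omega⟩ := Fin.ext (by simp only [hU]; omega)
      have he' : e = ⟨n - 2, by omega⟩ := Fin.ext (by simp only; omega)
      rw [hw, hrot'Last, hu, ← he']
    · have hlt : e.val + 2 < n := by omega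
      exact Or.inr ⟨⟨e.val + 2, hlt⟩, ⟨e.val + 1, h1⟩, rfl, hrot'Int (e.val + 1) (by omega) h1⟩
  have hrU := fun c => usesEdge_of_line_eq (hredT e c)
  have hsU := fun c => usesEdge_of_line_eq (hredF e c)
  have hold_inl : ∀ i a b, M'.usesEdge (Sum.inl i) (Sum.inl a) (Sum.inl b) ↔ M.usesEdge i a b := by
    intro i a b
    simp only [usesEdge, hold, List.pair_infix_map Sum.inl_injective]
  have hold_inr : ∀ i a b, ¬ M'.usesEdge (Sum.inl i) a (Sum.inr b) := by
    rintro i a b (h | h) <;> rw [hold] at h <;> simpa using h.subset (show Sum.inr b ∈ _ by simp)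
  -- the ports used by an old line that does not end at the left or at the right endpoint of `e`
  have holdU : ∀ i, M.usesEdge i U W → ¬ M.Terminal i U → ∃ T : Fin n, T.val + 1 = e.val ∧
      ∀ t, M'.usesEdge (Sum.inl i) (Sum.inl U) t ↔ t = Sum.inl T ∨ t = Sum.inl W := by
    intro i hi ht
    obtain ⟨T, hTW, hT⟩ := hi.exists_ne ht
    have hadj : ∀ t, M.usesEdge i U t → t.val = e.val + 1 ∨ t.val + 1 = e.val := fun t h => by
      simpa [hU, eq_comm] using (hMadj _ _).1 h.adj
    have hTe : T.val + 1 = e.val := (hadj T hT).resolve_left fun h => hTW (Fin.ext h)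
    refine ⟨T, hTe, ?_⟩
    rintro (t | t)
    · simp only [hold_inl, Sum.inl.injEq]
      refine ⟨fun h => ?_, by rintro (rfl | rfl) <;> assumption⟩
      rcases hadj t h with h | h
      · exact Or.inr (Fin.ext h)
      · exact Or.inl (Fin.ext (by omega))
    · simp [hold_inr]
  have holdW : ∀ i, M.usesEdge i U W → ¬ M.Terminal i W → ∃ T : Fin n, T.val = W.val + 1 ∧
      ∀ t, M'.usesEdge (Sum.inl i) (Sum.inl W) t ↔ t = Sum.inl T ∨ t = Sum.inl U := by
    intro i hi ht
    obtain ⟨T, hTU, hT⟩ := hi.symm.exists_ne ht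
    have hadj : ∀ t, M.usesEdge i W t → t.val = W.val + 1 ∨ t.val = e.val := fun t h => by
      simpa [hW, eq_comm] using (hMadj _ _).1 h.adj
    have hTe : T.val = W.val + 1 := (hadj T hT).resolve_right fun h => hTU (Fin.ext h)
    refine ⟨T, hTe, ?_⟩
    rintro (t | t)
    · simp only [hold_inl, Sum.inl.injEq]
      refine ⟨fun h => ?_, by rintro (rfl | rfl) <;> [exact hT; exact hi.symm]⟩
      rcases hadj t h with h | h
      · exact Or.inl (Fin.ext (by omega))
      · exact Or.inr (Fin.ext h)
    · simp [hold_inr]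
  have hrsU : ∀ c d, [Sum.inr (e, c, true), Sum.inr (e, d, false)].Sublist
      (lay.ord (Sum.inl U) (Sum.inl W)) := fun c d =>
    hlay.pair_sublist (by simp)
      (by rcases hrotU with ⟨-, h⟩ | ⟨T, e', -, h⟩ <;> exact ⟨0, by simp [h]⟩)
      (fun t => (hrU c t).1) (fun t => (hsU d t).1.trans or_comm)
  have hrsW : ∀ c d, [Sum.inr (e, c, true), Sum.inr (e, d, false)].Sublist
      (lay.ord (Sum.inl W) (Sum.inl U)) := fun c d =>
    hlay.pair_sublist (by simp)
      (by
        rcases hrotW with ⟨-, h⟩ | ⟨T, e', -, h⟩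
        · exact ⟨1, by simp [h]⟩
        · exact ⟨4, by simp [h]⟩)
      (fun t => (hrU c t).2) (fun t => (hsU d t).2.trans or_comm)
  have hmidU : ∀ i, M.usesEdge i U W → ¬ M.Terminal i U → ∀ c,
      [Sum.inr (e, c, true), Sum.inl i].Sublist (lay.ord (Sum.inl U) (Sum.inl W)) ∧
      [Sum.inl i, Sum.inr (e, c, false)].Sublist (lay.ord (Sum.inl U) (Sum.inl W)) := by
    intro i hi ht c
    obtain ⟨T, hT, hedge⟩ := holdU i hi ht
    rcases hrotU with ⟨h0, -⟩ | ⟨T', e', hT', h⟩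
    · omega
    obtain rfl : T = T' := Fin.ext (by omega)
    exact ⟨hlay.pair_sublist (by simp) ⟨0, by simp [h]⟩ (fun t => (hrU c t).1)
        (fun t => (hedge t).trans or_comm),
      hlay.pair_sublist (by simp) ⟨5, by simp [h]⟩ hedge (fun t => (hsU c t).1.trans or_comm)⟩
  have hmidW : ∀ i, M.usesEdge i U W → ¬ M.Terminal i W → ∀ c,
      [Sum.inr (e, c, true), Sum.inl i].Sublist (lay.ord (Sum.inl W) (Sum.inl U)) ∧
      [Sum.inl i, Sum.inr (e, c, false)].Sublist (lay.ord (Sum.inl W) (Sum.inl U)) := by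
    intro i hi ht c
    obtain ⟨T, hT, hedge⟩ := holdW i hi ht
    rcases hrotW with ⟨h0, -⟩ | ⟨T', e', hT', h⟩
    · have := T.isLt
      simp only [hW] at hT
      omega
    obtain rfl : T = T' := Fin.ext (by omega)
    exact ⟨hlay.pair_sublist (by simp) ⟨4, by simp [h]⟩ (fun t => (hrU c t).2)
        (fun t => (hedge t).trans or_comm),
      hlay.pair_sublist (by simp) ⟨2, by simp [h]⟩ hedge (fun t => (hsU c t).2.trans or_comm)⟩
  -- an old line cannot precede the descending and follow the ascending red line at a port
  have hsplit : ∀ i c a b, M'.usesEdge (Sum.inl i) a b →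
      [Sum.inr (e, c, true), Sum.inr (e, c, false)].Sublist (lay.ord a b) →
      [Sum.inr (e, c, true), Sum.inl i].Sublist (lay.ord a b) ∨
      [Sum.inl i, Sum.inr (e, c, false)].Sublist (lay.ord a b) := by
    intro i c a b hi h
    refine (List.pair_sublist_or (h.subset (by simp)) ((lay.mem_iff a b _).2 hi)
      (by simp)).imp_right fun h' => (lay.nodup a b).pair_sublist_trans h' h
  refine card_add_card_le _ _ _ (fun c => (e, c, true)) (fun c => (e, c, false))
    (fun c d h => by simpa using h) (fun c d h => by simpa using h)
    (fun i h h' => h'.2 h.2) ?_ ?_ ?_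
  · rintro i ⟨hi, ht⟩ c
    have hi' : M'.usesEdge (Sum.inl i) (Sum.inl U) (Sum.inl W) := (hold_inl _ _ _).2 hi
    have hnot := hi.not_terminal_both (hlong i)
    by_cases hU' : M.Terminal i U
    · have h := hmidW i hi (fun h => hnot ⟨hU', h⟩) c
      rcases hsplit i c _ _ hi' (hrsU c c) with h' | h'
      · exact Or.inl ⟨⟨by simp, h', h.1⟩, Or.inl ⟨_, rfl⟩⟩
      · exact Or.inr ⟨⟨by simp, h', h.2⟩, Or.inr ⟨_, rfl⟩⟩
    · have h := hmidU i hi hU' c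
      rcases hsplit i c _ _ hi'.symm (hrsW c c) with h' | h'
      · exact Or.inl ⟨⟨by simp, h.1, h'⟩, Or.inl ⟨_, rfl⟩⟩
      · exact Or.inr ⟨⟨by simp, h.2, h'⟩, Or.inr ⟨_, rfl⟩⟩
  · rintro i ⟨hi, ht⟩ c
    have hu := hmidU i hi (fun h => ht (Or.inl h)) c
    have hw := hmidW i hi (fun h => ht (Or.inr h)) c
    exact ⟨⟨⟨by simp, hu.1, hw.1⟩, Or.inl ⟨_, rfl⟩⟩, ⟨⟨by simp, hu.2, hw.2⟩, Or.inr ⟨_, rfl⟩⟩⟩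
  · exact fun c d => ⟨⟨by simp, hrsU c d, hrsW c d⟩, Or.inl ⟨_, rfl⟩⟩
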